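/- Let (Δ,δ) be a building of type (W,S) where W satisfies the nested condition relative to u ∈ S, let G be a group acting isometrically on Δ, fix a chamber C₀ ∈ Δ, and let G₀ := {g ∈ G : δ(C₀, g•C₀) ∈ W_{T_u}} with T_u := {s ∈ S : m_{su} = 2}. If G has a global fixed chamber, i.e. there exists C₀' ∈ Δ with g•C₀' = C₀' for every g ∈ G, then the multiplier m_G^u is trivial on G: there is a constant c ∈ {1, −1} such that m_G^u(g) = c for every g ∈ G \ G₀. -/

import Mathlib

open Pointwise
open scoped Classical

variable {B : Type*} {W : Type*} [Group W] {M : CoxeterMatrix B}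

/-- The positive root `H_s^+` associated to the generator indexed by `i`:
elements `g` with `l(sg) > l(g)`. -/
def Hp (cs : CoxeterSystem M W) (i : B) : Set W :=
  {g : W | cs.length g < cs.length (cs.simple i * g)}

/-- The negative root `H_s^-`: elements `g` with `l(sg) < l(g)`. -/
def Hm (cs : CoxeterSystem M W) (i : B) : Set W :=
  {g : W | cs.length (cs.simple i * g) < cs.length g}

/-- `g` satisfies one of the six cases of the nested condition relative to `s`. -/
def NestedAt (cs : CoxeterSystem M W) (i : B) (g : W) : Prop :=
  g • Hp cs i = Hp cs i ∨ g • Hp cs i = Hm cs i ∨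
  g • Hp cs i ⊂ Hp cs i ∨ g • Hp cs i ⊂ Hm cs i ∨
  g • Hm cs i ⊂ Hp cs i ∨ g • Hm cs i ⊂ Hm cs i

/-- `W` satisfies the nested condition relative to the generator indexed by `i`. -/
def Nested (cs : CoxeterSystem M W) (i : B) : Prop := ∀ g : W, NestedAt cs i g

/-- The stabilizer `Stab_{H_s^+}` of the positive root. -/
def StabHp (cs : CoxeterSystem M W) (i : B) : Set W :=
  {g : W | g • Hp cs i = Hp cs i}

/-- The multiplier `m_W^s`. -/
noncomputable def mWs (cs : CoxeterSystem M W) (i : B) (g : W) : ℤ :=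
  if g ∈ Hp cs i then 1 else -1

/-- `(Δ, d)` is a building of type `(W,S)`: axioms (B1), (B2), (B3). -/
def IsBuilding (cs : CoxeterSystem M W) (Δ : Type*) (d : Δ → Δ → W) : Prop :=
  Nonempty Δ ∧
  (∀ C D : Δ, d C D = 1 ↔ C = D) ∧
  (∀ (C D E : Δ) (i : B), d E C = cs.simple i →
    (d E D = cs.simple i * d C D ∨ d E D = d C D) ∧
    (cs.length (d C D) < cs.length (cs.simple i * d C D) → d E D = cs.simple i * d C D)) ∧
  (∀ (C D : Δ) (i : B), ∃ E : Δ, d E C = cs.simple i ∧ d E D = cs.simple i * d C D)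

/-- `φ : W → Δ` is an isometry into the building. -/
def IsIsom {Δ : Type*} (d : Δ → Δ → W) (φ : W → Δ) : Prop :=
  ∀ a b : W, d (φ a) (φ b) = a⁻¹ * b

/-- The parabolic subgroup `W_{T_u}` where `T_u = {s ∈ S : m_{su} = 2}`. -/
def WTu (cs : CoxeterSystem M W) (u : B) : Subgroup W :=
  Subgroup.closure (cs.simple '' {j : B | M j u = 2})

/-- The multiplier `m_G^u` for a group `G` acting on the building. -/
noncomputable def mG {G : Type*} [Group G] (cs : CoxeterSystem M W) {Δ : Type*}
    (d : Δ → Δ → W) [MulAction G Δ] (C₀ : Δ) (u : B) (g : G) : ℤ :=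
  if cs.length (d C₀ (g • C₀)) < cs.length (cs.simple u * d C₀ (g • C₀)) then 1 else -1

section ReflectionRepresentation

open Module Polynomial.Chebyshev

/-- The column of the doubled Gram matrix of a Coxeter matrix indexed by `i`. -/
noncomputable def gramColumn (M : CoxeterMatrix B) (i : B) : B → ℝ :=
  fun j => -2 * Real.cos (Real.pi / M j i)

theorem proj_gramColumn_self (M : CoxeterMatrix B) (i : B) :
    (LinearMap.proj i : Dual ℝ (B → ℝ)) (gramColumn M i) = 2 := by
  simp [gramColumn]

/-- The simple reflections of the contragredient of the reflection representation. -/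
noncomputable def simpleReflection (M : CoxeterMatrix B) (i : B) : (B → ℝ) ≃ₗ[ℝ] (B → ℝ) :=
  reflection (proj_gramColumn_self M i)

theorem simpleReflection_apply (M : CoxeterMatrix B) (i : B) (f : B → ℝ) :
    simpleReflection M i f = f - f i • gramColumn M i := by
  simp [simpleReflection, reflection_apply]

theorem gramColumn_comm (M : CoxeterMatrix B) (i j : B) :
    gramColumn M i j = gramColumn M j i := by
  simp [gramColumn, M.symmetric]

theorem isLiftable_simpleReflection (M : CoxeterMatrix B) :
    M.IsLiftable (simpleReflection M) := by
  intro i j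
  by_cases hij : i = j
  · subst hij
    rw [M.diagonal, pow_one]
    ext1 f
    exact involutive_reflection (proj_gramColumn_self M i) f
  have h1 := M.off_diagonal i j hij
  by_cases h0 : M i j = 0
  · rw [h0, pow_zero]
  by_cases h2 : M i j = 2
  · have hji : gramColumn M j i = 0 := by simp [gramColumn, h2]
    have hij0 : gramColumn M i j = 0 := by rw [gramColumn_comm, hji]
    rw [h2, pow_two]
    refine LinearEquiv.ext fun f => ?_
    simp only [LinearEquiv.mul_apply, simpleReflection_apply]
    have ii : gramColumn M i i = 2 := proj_gramColumn_self M i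
    have jj : gramColumn M j j = 2 := proj_gramColumn_self M j
    funext k
    change _ = f k
    simp only [Pi.sub_apply, Pi.smul_apply, smul_eq_mul, hji, hij0, ii, jj]
    ring
  have h3 : 3 ≤ M i j := by omega
  set m := M i j with hm
  have hmR : (3 : ℝ) ≤ m := by exact_mod_cast h3
  set θ : ℝ := 2 * Real.pi / m with hθ
  have hsin : Real.sin θ ≠ 0 := by
    apply ne_of_gt
    apply Real.sin_pos_of_pos_of_lt_pi
    · have := Real.pi_pos
      positivity
    · rw [hθ, div_lt_iff₀ (by linarith)]
      nlinarith [Real.pi_pos]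
  have ht : gramColumn M j i * gramColumn M i j - 2 = 2 * Real.cos θ := by
    rw [gramColumn_comm M i j]
    have : θ = 2 * (Real.pi / m) := by rw [hθ]; ring
    rw [this, Real.cos_two_mul]
    simp only [gramColumn, ← hm]
    ring
  refine LinearEquiv.ext fun f => ?_
  refine (reflection_mul_reflection_pow_apply (proj_gramColumn_self M i)
    (proj_gramColumn_self M j) m f (2 * Real.cos θ) ht.symm).trans ?_
  have hmθ : (m : ℝ) * θ = 2 * Real.pi := by
    rw [hθ]; field_simp
  obtain ⟨k, hk | hk⟩ : ∃ k : ℤ, (m : ℤ) = 2 * k ∨ (m : ℤ) = 2 * k + 1 :=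
    ⟨m / 2, by omega⟩
  · have hk' : (m : ℝ) = 2 * k := by exact_mod_cast hk
    have hS : (S ℝ (k - 1)).eval (2 * Real.cos θ) = 0 := by
      have := S_two_mul_real_cos θ (k - 1)
      push_cast at this
      rw [show ((k : ℝ) - 1 + 1) * θ = Real.pi by rw [hk'] at hmθ; linarith, Real.sin_pi] at this
      exact (mul_eq_zero.1 this).resolve_right hsin
    rw [show ((m : ℤ) - 2) / 2 = k - 1 by omega, show ((m : ℤ) - 1) / 2 = k - 1 by omega, hS]
    simp
  · have hk' : (m : ℝ) = 2 * k + 1 := by exact_mod_cast hk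
    have hS : (S ℝ k).eval (2 * Real.cos θ) + (S ℝ (k - 1)).eval (2 * Real.cos θ) = 0 := by
      have e1 := S_two_mul_real_cos θ k
      have e2 := S_two_mul_real_cos θ (k - 1)
      push_cast at e2
      rw [show ((k : ℝ) + 1) * θ = 2 * Real.pi - ((k : ℝ) - 1 + 1) * θ by
        rw [hk'] at hmθ; linarith, Real.sin_two_pi_sub] at e1
      refine (mul_eq_zero.1 ?_).resolve_right hsin
      rw [add_mul, e1, e2]
      ring
    rw [show ((m : ℤ) - 2) / 2 = k - 1 by omega, show ((m : ℤ) - 1) / 2 = k by omega,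
      show ((m : ℤ) - 3) / 2 = k - 1 by omega, show (m : ℤ) / 2 = k by omega, hS]
    simp

theorem simple_injective (cs : CoxeterSystem M W) : Function.Injective cs.simple := by
  intro i j hij
  by_contra hne
  have h := congrArg (cs.lift ⟨_, isLiftable_simpleReflection M⟩) hij
  rw [cs.lift_apply_simple, cs.lift_apply_simple] at h
  have := congrFun (LinearEquiv.congr_fun h (Pi.single i 1)) i
  rw [simpleReflection_apply, simpleReflection_apply] at this
  have ii : gramColumn M i i = 2 := proj_gramColumn_self M i
  simp [ii, Ne.symm hne] at this

theorem matrix_eq_two_of_commute (cs : CoxeterSystem M W) {i j : B} (hne : i ≠ j)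
    (hij : cs.simple i * cs.simple j = cs.simple j * cs.simple i) : M i j = 2 := by
  have h := congrArg (cs.lift ⟨_, isLiftable_simpleReflection M⟩) hij
  simp only [map_mul, cs.lift_apply_simple] at h
  have := congrFun (LinearEquiv.congr_fun h (Pi.single j 1)) i
  have ii : gramColumn M i i = 2 := proj_gramColumn_self M i
  simp only [LinearEquiv.mul_apply, simpleReflection_apply] at this
  simp [ii, hne] at this
  have h0 : Real.cos (Real.pi / M i j) = 0 := by
    have h' : gramColumn M j i = 0 := by linarith
    simpa [gramColumn] using h'
  by_cases hm : M i j = 0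
  · simp [hm] at h0
  have hpos : (1 : ℝ) ≤ M i j := by exact_mod_cast Nat.one_le_iff_ne_zero.2 hm
  have hpi := Real.pi_pos
  have := Real.injOn_cos (x₁ := Real.pi / M i j) (x₂ := Real.pi / 2)
    ⟨by positivity, div_le_self hpi.le hpos⟩ ⟨by positivity, by linarith⟩
    (by rw [h0, Real.cos_pi_div_two])
  have h2 : (M i j : ℝ) = 2 := by
    field_simp at this
    linarith
  exact_mod_cast h2

end ReflectionRepresentation

section Exchange

/-- The action of a simple reflection on `W × ℤ/2` whose second component counts, modulo two,
the inversions met along a word. -/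
noncomputable def inversionParity (cs : CoxeterSystem M W) (i : B) :
    Function.End (W × ZMod 2) :=
  fun x => (cs.simple i * x.1 * cs.simple i, x.2 + if x.1 = cs.simple i then 1 else 0)

theorem isLiftable_inversionParity (cs : CoxeterSystem M W) :
    M.IsLiftable (inversionParity cs) := by
  intro i j
  set p := cs.simple i * cs.simple j with hp
  set c : W → ℕ → ZMod 2 := fun t l => if p ^ l * t = cs.simple j then 1 else 0 with hc
  have hjp : ∀ l : ℕ, cs.simple j * p ^ l = (p ^ l)⁻¹ * cs.simple j := fun l => by
    have h : SemiconjBy (cs.simple j) p p⁻¹ := by simp [SemiconjBy, hp, mul_assoc]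
    simpa using (h.pow_right l).eq
  have key : ∀ (n : ℕ) (t : W) (ε : ZMod 2),
      ((inversionParity cs i * inversionParity cs j) ^ n) (t, ε) =
        (p ^ n * t * (p ^ n)⁻¹, ε + ∑ l ∈ Finset.range (2 * n), c t l) := by
    intro n t ε
    induction n with
    | zero =>
      simp only [pow_zero, one_mul, inv_one, mul_one, mul_zero, Finset.range_zero,
        Finset.sum_empty, add_zero]
      rfl
    | succ n ih =>
      rw [pow_succ']
      change inversionParity cs i (inversionParity cs j
        (((inversionParity cs i * inversionParity cs j) ^ n) (t, ε))) = _
      have e1 : p ^ n * t * (p ^ n)⁻¹ = cs.simple j ↔ p ^ (2 * n) * t = cs.simple j := by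
        rw [mul_inv_eq_iff_eq_mul, hjp, eq_inv_mul_iff_mul_eq, ← mul_assoc, ← pow_add, two_mul]
      have e2 : cs.simple j * (p ^ n * t * (p ^ n)⁻¹) * cs.simple j = cs.simple i ↔
          p ^ (2 * n + 1) * t = cs.simple j := by
        rw [← eq_mul_inv_iff_mul_eq, cs.inv_simple, ← hp, ← eq_inv_mul_iff_mul_eq, cs.inv_simple,
          mul_inv_eq_iff_eq_mul, mul_assoc, ← pow_succ', hjp, eq_inv_mul_iff_mul_eq, ← mul_assoc,
          ← pow_add, show n + 1 + n = 2 * n + 1 by ring]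
      rw [ih, show 2 * (n + 1) = 2 * n + 1 + 1 by ring, Finset.sum_range_succ,
        Finset.sum_range_succ]
      simp only [inversionParity, e1, e2, hc, Prod.mk.injEq]
      refine ⟨?_, by ring⟩
      rw [pow_succ' p n, mul_inv_rev]
      simp [hp, mul_assoc]
  funext ⟨t, ε⟩
  have hpm : p ^ M i j = 1 := cs.simple_mul_simple_pow i j
  have hsum : ∑ l ∈ Finset.range (2 * M i j), c t l = 0 := by
    rw [two_mul, Finset.sum_range_add]
    simp only [hc, pow_add, hpm, one_mul]
    exact CharTwo.add_self_eq_zero _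
  rw [key, hsum, hpm]
  simp only [one_mul, inv_one, mul_one, add_zero]
  rfl

theorem mem_leftInvSeq_of_inversionParity_ne (cs : CoxeterSystem M W) (ω : List B) (t : W)
    (ε : ZMod 2)
    (h : (cs.lift ⟨_, isLiftable_inversionParity cs⟩ (cs.wordProd ω)⁻¹ (t, ε)).2 ≠ ε) :
    t ∈ cs.leftInvSeq ω := by
  induction ω generalizing t ε with
  | nil =>
    rw [cs.wordProd_nil, inv_one, map_one] at h
    exact absurd rfl h
  | cons i ω ih =>
    rw [cs.wordProd_cons, mul_inv_rev, map_mul, cs.inv_simple] at h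
    change (cs.lift ⟨_, isLiftable_inversionParity cs⟩ (cs.wordProd ω)⁻¹
      (cs.lift ⟨_, isLiftable_inversionParity cs⟩ (cs.simple i) (t, ε))).2 ≠ ε at h
    rw [cs.lift_apply_simple] at h
    by_cases ht : t = cs.simple i
    · simp [CoxeterSystem.leftInvSeq, ht]
    · simp only [inversionParity, ht, if_false, add_zero] at h
      have := ih _ _ h
      simp only [CoxeterSystem.leftInvSeq, List.mem_cons, List.mem_map]
      exact Or.inr ⟨_, this, by simp [mul_assoc]⟩

theorem inversionParity_eq_one_iff (cs : CoxeterSystem M W) (i : B) (w : W) :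
    (cs.lift ⟨_, isLiftable_inversionParity cs⟩ w⁻¹ (cs.simple i, 0)).2 = 1 ↔
      cs.length (cs.simple i * w) < cs.length w := by
  have key : ∀ (w : W) (ε : ZMod 2),
      (cs.lift ⟨_, isLiftable_inversionParity cs⟩ w⁻¹ (cs.simple i, ε)).2 ≠ ε →
      cs.length (cs.simple i * w) < cs.length w := by
    intro w ε h
    obtain ⟨ω, hω, rfl⟩ := cs.exists_isReduced w
    exact (cs.isLeftInversion_of_mem_leftInvSeq hω
      (mem_leftInvSeq_of_inversionParity_ne cs ω _ ε h)).2
  refine ⟨fun h => key w 0 (by rw [h]; decide), fun h => ?_⟩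
  by_contra hne
  have h2 := key (cs.simple i * w) 1 (by
    rw [mul_inv_rev, map_mul, cs.inv_simple]
    change (cs.lift ⟨_, isLiftable_inversionParity cs⟩ w⁻¹
      (cs.lift ⟨_, isLiftable_inversionParity cs⟩ (cs.simple i) (cs.simple i, 1))).2 ≠ 1
    rw [cs.lift_apply_simple]
    simp only [inversionParity, if_true, cs.simple_mul_simple_self, one_mul]
    exact hne)
  rw [cs.simple_mul_simple_cancel_left] at h2
  omega

/-- If right multiplication by a simple reflection creates the left descent `i`, then it amounts
to left multiplication by the simple reflection `i`. -/
theorem simple_mul_eq_mul_simple (cs : CoxeterSystem M W) {i j : B} {a : W}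
    (h1 : cs.length a < cs.length (cs.simple i * a))
    (h2 : cs.length (cs.simple i * (a * cs.simple j)) < cs.length (a * cs.simple j)) :
    cs.simple i * a = a * cs.simple j := by
  have h1' := (inversionParity_eq_one_iff cs i a).not.2 (by omega)
  rw [← inversionParity_eq_one_iff, mul_inv_rev, map_mul, cs.inv_simple] at h2
  change (cs.lift ⟨_, isLiftable_inversionParity cs⟩ (cs.simple j)
      (cs.lift ⟨_, isLiftable_inversionParity cs⟩ a⁻¹ (cs.simple i, 0))).2 = 1 at h2
  have hfst : ∀ (w : W) (x : W × ZMod 2),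
      (cs.lift ⟨_, isLiftable_inversionParity cs⟩ w x).1 = w * x.1 * w⁻¹ := by
    intro w
    induction w using cs.simple_induction_left with
    | one =>
      intro x
      rw [map_one, one_mul, inv_one, mul_one]
      rfl
    | mul_simple_left w k ih =>
      intro x
      rw [map_mul, cs.lift_apply_simple]
      change cs.simple k * (cs.lift ⟨_, isLiftable_inversionParity cs⟩ w x).1 * cs.simple k = _
      rw [ih]
      simp [mul_assoc]
  rw [cs.lift_apply_simple] at h2
  simp only [inversionParity, hfst] at h2
  split_ifs at h2 with h
  · rw [← h]; group
  · exact absurd (by simpa using h2) h1'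

end Exchange

section Nested

variable (cs : CoxeterSystem M W) {u : B}

theorem mem_Hm_iff_notMem_Hp {g : W} : g ∈ Hm cs u ↔ g ∉ Hp cs u := by
  have := cs.length_simple_mul_ne g u
  simp only [Hm, Hp, Set.mem_ofPred_eq]
  omega

theorem Hm_eq_compl : Hm cs u = (Hp cs u)ᶜ := Set.ext fun _ => mem_Hm_iff_notMem_Hp cs

theorem one_mem_Hp : (1 : W) ∈ Hp cs u := by
  simp [Hp]

theorem simple_mem_Hm : cs.simple u ∈ Hm cs u := by
  simp [Hm]

/-- If a wall separates the chamber of `u` from some other chamber of the negative root of `u`,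
then reflecting in that wall does not move the negative root off itself. -/
theorem exists_mem_Hm_conj_mem_Hm {i : B} {a v : W} (hv : v ∈ Hm cs u)
    (h1 : cs.length (a * cs.simple u) < cs.length (cs.simple i * (a * cs.simple u)))
    (h2 : cs.length (cs.simple i * (a * v)) < cs.length (a * v)) :
    ∃ p ∈ Hm cs u, a⁻¹ * cs.simple i * a * p ∈ Hm cs u := by
  induction hn : cs.length v using Nat.strong_induction_on generalizing v with
  | _ n ih =>
  subst hn
  have hvu : cs.simple u * v ≠ 1 := by
    intro h
    have : v = cs.simple u := by
      rw [mul_eq_one_iff_inv_eq, cs.inv_simple] at h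
      exact h.symm
    subst this
    omega
  obtain ⟨j, hj⟩ := cs.exists_rightDescent_of_ne_one hvu
  rw [cs.isRightDescent_iff] at hj
  have hv1 := cs.length_simple_mul v u
  have hv2 := cs.length_mul_simple v j
  have hv' : cs.length (cs.simple u * v) < cs.length v := hv
  have hv3 := cs.length_simple_mul (v * cs.simple j) u
  rw [← mul_assoc] at hv3
  have hp : v * cs.simple j ∈ Hm cs u := by
    change cs.length (cs.simple u * (v * cs.simple j)) < cs.length (v * cs.simple j)
    rw [← mul_assoc]
    omega
  by_cases hs : cs.length (cs.simple i * (a * (v * cs.simple j))) <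
      cs.length (a * (v * cs.simple j))
  · exact ih _ (by omega) hp hs rfl
  · have hne := cs.length_simple_mul_ne (a * (v * cs.simple j)) i
    have := simple_mul_eq_mul_simple cs (i := i) (j := j) (a := a * (v * cs.simple j))
      (by omega) (by simpa [mul_assoc] using h2)
    refine ⟨v * cs.simple j, hp, ?_⟩
    rw [mul_assoc, mul_assoc, this]
    simpa [mul_assoc] using hv

theorem Nested.smul_Hp_eq_or_smul_Hm_subset (hnest : Nested cs u) {r x : W} (hr : r * r = 1)
    (hx : x ∈ Hp cs u) (hrx : r * x ∈ Hp cs u) :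
    r • Hp cs u = Hp cs u ∨ r • Hm cs u ⊆ Hp cs u := by
  have hmem : r * x ∈ r • Hp cs u := Set.smul_mem_smul_set hx
  have hdisj : r * x ∉ Hm cs u := fun h => (mem_Hm_iff_notMem_Hp cs).1 h hrx
  have hinvol : ∀ A : Set W, ¬ r • A ⊂ A := by
    intro A hA
    refine hA.2 ?_
    have := Set.smul_set_mono (a := r) hA.1
    rwa [smul_smul, hr, one_smul] at this
  rcases hnest r with h | h | h | h | h | h
  · exact Or.inl h
  · exact absurd (h ▸ hmem) hdisj
  · exact absurd h (hinvol _)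
  · exact absurd (h.1 hmem) hdisj
  · exact Or.inr h.1
  · exact absurd h (hinvol _)

theorem smul_Hm_of_smul_Hp {g : W} (h : g • Hp cs u = Hp cs u) : g • Hm cs u = Hm cs u := by
  rw [Hm_eq_compl, Set.smul_set_compl, h]

theorem simple_mem_Hp {i : B} (hi : i ≠ u) : cs.simple i ∈ Hp cs u := by
  rw [← not_not (a := _ ∈ Hp cs u), ← mem_Hm_iff_notMem_Hp]
  intro h
  have h' : cs.length (cs.simple u * cs.simple i) < cs.length (cs.simple i) := h
  rw [cs.length_simple, Nat.lt_one_iff, cs.length_eq_zero_iff, mul_eq_one_iff_inv_eq,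
    cs.inv_simple] at h'
  exact hi (simple_injective cs h').symm

theorem Nested.simple_smul_Hp (hnest : Nested cs u) {i : B} (hi : M i u = 2) :
    cs.simple i • Hp cs u = Hp cs u := by
  have hne : i ≠ u := by
    rintro rfl
    simp at hi
  have hcomm : cs.simple i * cs.simple u = cs.simple u * cs.simple i := by
    have := cs.simple_mul_simple_pow i u
    rw [hi, pow_two, mul_eq_one_iff_eq_inv, mul_inv_rev, cs.inv_simple, cs.inv_simple] at this
    exact this
  refine (hnest.smul_Hp_eq_or_smul_Hm_subset cs (cs.simple_mul_simple_self i) (one_mem_Hp cs)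
    (by simpa using simple_mem_Hp cs hne)).resolve_right fun h => ?_
  have h' : cs.simple i * cs.simple u ∈ Hp cs u :=
    h (Set.smul_mem_smul_set (simple_mem_Hm cs))
  have h2 := simple_mem_Hp cs hne
  simp only [Hp, Set.mem_ofPred_eq] at h' h2
  rw [hcomm, cs.simple_mul_simple_cancel_left] at h'
  omega

theorem Nested.smul_Hp_of_mem_WTu (hnest : Nested cs u) {t : W} (ht : t ∈ WTu cs u) :
    t • Hp cs u = Hp cs u := by
  have : WTu cs u ≤ MulAction.stabilizer W (Hp cs u) := by
    rw [WTu, Subgroup.closure_le]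
    rintro _ ⟨i, hi, rfl⟩
    exact hnest.simple_smul_Hp cs hi
  exact this ht

theorem Nested.mul_mem_Hm (hnest : Nested cs u) {t v : W} (ht : t ∈ WTu cs u)
    (hv : v ∈ Hm cs u) : t * v ∈ Hm cs u := by
  rw [← smul_Hm_of_smul_Hp cs (hnest.smul_Hp_of_mem_WTu cs ht)]
  exact Set.smul_mem_smul_set hv

theorem Nested.mem_WTu_of_smul_Hp (hnest : Nested cs u) {g : W}
    (hg : g • Hp cs u = Hp cs u) : g ∈ WTu cs u := by
  induction hn : cs.length g using Nat.strong_induction_on generalizing g with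
  | _ n ih =>
  subst hn
  by_cases hg1 : g = 1
  · rw [hg1]; exact one_mem _
  obtain ⟨i, hi⟩ := cs.exists_leftDescent_of_ne_one hg1
  rw [cs.isLeftDescent_iff] at hi
  have hgp : g ∈ Hp cs u := by
    rw [← hg]
    exact ⟨1, one_mem_Hp cs, by simp⟩
  have hgm : g * cs.simple u ∈ Hm cs u := by
    rw [← smul_Hm_of_smul_Hp cs hg]
    exact Set.smul_mem_smul_set (simple_mem_Hm cs)
  have hne : i ≠ u := by
    rintro rfl
    have : cs.length g < cs.length (cs.simple i * g) := hgp
    omega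
  have hcomm := simple_mul_eq_mul_simple cs (i := u) (j := u) (a := g) hgp hgm
  have hsu := simple_mem_Hp cs (Ne.symm hne)
  have hstab : cs.simple i • Hp cs u = Hp cs u := by
    refine (hnest.smul_Hp_eq_or_smul_Hm_subset cs (cs.simple_mul_simple_self i) (one_mem_Hp cs)
      (by simpa using simple_mem_Hp cs hne)).resolve_right fun h => ?_
    obtain ⟨p, hp, hp'⟩ := exists_mem_Hm_conj_mem_Hm cs (i := i) (a := 1) hgm
      (by simpa [Hp] using hsu) (by
        have h1 := cs.length_mul_simple (cs.simple i * g) u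
        have h2 : cs.length g < cs.length (cs.simple u * g) := hgp
        rw [hcomm] at h2
        rw [one_mul, ← mul_assoc]
        omega)
    refine (mem_Hm_iff_notMem_Hp cs).1 hp' (h ?_)
    simpa using Set.smul_mem_smul_set (a := cs.simple i) hp
  have hu : cs.simple i * cs.simple u ∈ Hm cs u := by
    rw [← smul_Hm_of_smul_Hp cs hstab]
    exact Set.smul_mem_smul_set (simple_mem_Hm cs)
  have hM : M i u = 2 := matrix_eq_two_of_commute cs hne
    (simple_mul_eq_mul_simple cs (simple_mem_Hp cs hne) hu).symm
  have hs : cs.simple i ∈ WTu cs u := Subgroup.subset_closure ⟨i, hM, rfl⟩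
  have := ih _ (by omega) (g := cs.simple i * g)
    (by rw [mul_smul, hg, hstab]) rfl
  simpa using mul_mem hs this

end Nested

section Building

variable (cs : CoxeterSystem M W) {u : B} {Δ : Type*} {d : Δ → Δ → W}

theorem IsBuilding.dist_eq_inv_mul (hb : IsBuilding cs Δ d) {C D A : Δ}
    (h : cs.length ((d C D)⁻¹ * d C A) = cs.length (d C D) + cs.length (d C A)) :
    d D A = (d C D)⁻¹ * d C A := by
  obtain ⟨-, hB1, hB2, hB3⟩ := hb
  induction hn : cs.length (d C D) generalizing C with
  | zero =>
    rw [cs.length_eq_zero_iff] at hn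
    rw [hn, (hB1 C D).1 hn]
    simp
  | succ n ih =>
    have hne : d C D ≠ 1 := by
      intro h1
      rw [h1, cs.length_one] at hn
      omega
    obtain ⟨i, hi⟩ := cs.exists_leftDescent_of_ne_one hne
    rw [cs.isLeftDescent_iff] at hi
    obtain ⟨E, hEC, hED⟩ := hB3 C D i
    have hprod : (d C D)⁻¹ * d C A = (d E D)⁻¹ * (cs.simple i * d C A) := by
      rw [hED]; simp [mul_assoc]
    have h1 := cs.length_mul_le (d E D)⁻¹ (cs.simple i * d C A)
    rw [← hprod, cs.length_inv, h, hED] at h1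
    have hEA := (hB2 C A E i hEC).2 (by omega)
    have h2 := cs.length_simple_mul (d C A) i
    rw [hprod, ← hEA]
    refine ih ?_ (by rw [hED]; omega)
    rw [hEA, ← hprod, h, hED]
    omega

theorem IsBuilding.dist_symm (hb : IsBuilding cs Δ d) (C D : Δ) : d D C = (d C D)⁻¹ := by
  have hCC : d C C = 1 := (hb.2.1 C C).2 rfl
  have := hb.dist_eq_inv_mul cs (C := C) (D := D) (A := C) (by simp [hCC])
  simpa [hCC] using this

theorem IsBuilding.exists_dist_eq_mul (hb : IsBuilding cs Δ d) (hnest : Nested cs u)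
    {C D E : Δ} (hD : (d D C)⁻¹ ∈ Hp cs u) (hE : d C E ∈ Hm cs u) :
    ∃ t ∈ WTu cs u, d D E = d D C * t * d C E := by
  induction hn : cs.length (d D C) generalizing D with
  | zero =>
    rw [cs.length_eq_zero_iff] at hn
    obtain rfl := (hb.2.1 D C).1 hn
    exact ⟨1, one_mem _, by simp [hn]⟩
  | succ n ih =>
    have hne : d D C ≠ 1 := by
      intro h1
      rw [h1, cs.length_one] at hn
      omega
    obtain ⟨i, hi⟩ := cs.exists_leftDescent_of_ne_one hne
    rw [cs.isLeftDescent_iff] at hi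
    obtain ⟨F, hFD, hFC⟩ := hb.2.2.2 D C i
    have hDF : d D F = cs.simple i := by rw [hb.dist_symm cs F D, hFD, cs.inv_simple]
    obtain ⟨a, ha⟩ : ∃ a, d F C = a := ⟨_, rfl⟩
    rw [ha] at hFC
    have hDC : d D C = cs.simple i * a := by rw [hFC]; simp
    have hu : ∀ w : W, w⁻¹ ∈ Hp cs u ↔ cs.length w < cs.length (w * cs.simple u) := by
      intro w
      rw [Hp, Set.mem_ofPred_eq, cs.length_inv, ← cs.length_inv (cs.simple u * _)]
      simp
    have hD' := (hu _).1 hD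
    have hau := cs.length_mul_simple a u
    have hsau := cs.length_simple_mul (a * cs.simple u) i
    rw [hDC] at hD' hi
    rw [cs.simple_mul_simple_cancel_left] at hi
    rw [mul_assoc] at hD'
    have hF : a⁻¹ ∈ Hp cs u := (hu a).2 (by omega)
    obtain ⟨t, ht, hFE⟩ := ih (D := F) (by rwa [ha]) (by rw [hDC] at hn; rw [ha]; omega)
    rw [ha] at hFE
    have hB2 := hb.2.2.1 F E D i hDF
    set r := a⁻¹ * cs.simple i * a with hr
    have hra : r * a⁻¹ ∈ Hp cs u := by
      rw [hDC] at hD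
      simpa [hr, mul_assoc] using hD
    rcases hnest.smul_Hp_eq_or_smul_Hm_subset cs (r := r) (by simp [hr, mul_assoc]) hF hra with
      hstab | hsub
    · have hrT := hnest.mem_WTu_of_smul_Hp cs hstab
      rcases hB2.1 with h | h
      · exact ⟨t, ht, by rw [h, hFE, hDC]; simp only [mul_assoc]⟩
      · refine ⟨r * t, mul_mem hrT ht, ?_⟩
        rw [h, hFE, hDC]
        simp [hr, mul_assoc]
    · refine ⟨t, ht, ?_⟩
      rw [hB2.2, hFE, hDC]
      · simp only [mul_assoc]
      by_contra hlt
      have hneq := cs.length_simple_mul_ne (d F E) i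
      obtain ⟨p, hp, hp'⟩ := exists_mem_Hm_conj_mem_Hm cs (i := i) (a := a)
        (hnest.mul_mem_Hm cs ht hE) (by omega) (by
          rw [← mul_assoc a, ← hFE]
          omega)
      exact (mem_Hm_iff_notMem_Hp cs).1 hp' (hsub (Set.smul_mem_smul_set hp))

end Building

/-- If the action of `G` on the building has a global fixed chamber, then the multiplier
`m_G^u` is trivial (constant on `G \ G₀`). -/
theorem mG_trivial_of_global_fixed_chamber {G : Type*} [Group G] (cs : CoxeterSystem M W)
    (u : B) (hnest : Nested cs u) {Δ : Type*} (d : Δ → Δ → W) (hb : IsBuilding cs Δ d)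
    [MulAction G Δ] (hact : ∀ (g : G) (C D : Δ), d (g • C) (g • D) = d C D)
    (C₀ : Δ) (hfix : ∃ C₀' : Δ, ∀ g : G, g • C₀' = C₀') :
    ∃ c : ℤ, (c = 1 ∨ c = -1) ∧
      ∀ g : G, g ∉ {g : G | d C₀ (g • C₀) ∈ WTu cs u} → mG cs d C₀ u g = c := by
  obtain ⟨E, hE⟩ := hfix
  have hsymm := hb.dist_symm cs
  have hdE : ∀ g : G, d (g • C₀) E = d C₀ E := fun g => by
    conv_lhs => rw [← hE g]
    exact hact g C₀ E
  by_cases hv : d C₀ E ∈ Hp cs u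
  · refine ⟨1, Or.inl rfl, fun g hg => if_pos ?_⟩
    by_contra hw
    have hw' : d C₀ (g • C₀) ∈ Hm cs u := (mem_Hm_iff_notMem_Hp cs).2 hw
    obtain ⟨t, ht, h⟩ := hb.exists_dist_eq_mul cs hnest (D := E)
      (by rwa [← hsymm]) hw'
    rw [hsymm (g • C₀) E, hdE g, hsymm C₀ E, mul_assoc, left_eq_mul,
      mul_eq_one_iff_inv_eq] at h
    exact hg (show d C₀ (g • C₀) ∈ WTu cs u from h ▸ inv_mem ht)
  · refine ⟨-1, Or.inr rfl, fun g hg => if_neg fun hw => ?_⟩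
    have hv' := (mem_Hm_iff_notMem_Hp cs).2 hv
    obtain ⟨t, ht, h⟩ := hb.exists_dist_eq_mul cs hnest (D := g • C₀)
      (by rwa [← hsymm]) hv'
    rw [hdE g, right_eq_mul, hsymm C₀ (g • C₀), inv_mul_eq_one] at h
    exact hg (show d C₀ (g • C₀) ∈ WTu cs u from h ▸ ht)
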